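/- arXiv:math/0108167 — 3 statements merged into one kernel-verified Lean document; each statement's English description precedes it below -/
import Mathlib

section
/- Let k ≥ 2. Let A_{I₂(k)} be the Artin (generalized braid) group of type I₂(k), i.e. the group presented by two generators s₁, s₂ subject to the single relation s₁s₂s₁s₂⋯ = s₂s₁s₂s₁⋯ (alternating products with k factors on each side), let W_{I₂(k)} be the Coxeter group of type I₂(k) (the dihedral group of order 2k), and let π_S : A_{I₂(k)} → W_{I₂(k)} be the canonical surjection (adding the relations s₁² = s₂² = 1). Then there exist a natural number m, a group homomorphism f : A_{I₂(k)} → B_m into the braid group on m strands, and an injective group homomorphism e : W_{I₂(k)} → S_m into the symmetric group on m letters, such that π_m ∘ f = e ∘ π_S, where π_m : B_m → S_m is the canonical surjection sending σᵢ to the transposition (i, i+1). -/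
/-!
Braid group infrastructure.

`BraidGroup m` is the Artin braid group on `m` strands, presented with generators
`σ 0, …, σ (m-2)` (here `σ i` denotes the usual generator `σ_{i+1}`) and the braid
relations `σ i * σ j = σ j * σ i` for `|i - j| ≥ 2` and
`σ i * σ j * σ i = σ j * σ i * σ j` for `j = i + 1`.
-/

/-- The braid relations on `m` strands (generators indexed by `Fin (m - 1)`). -/
def braidRels (m : ℕ) : Set (FreeGroup (Fin (m - 1))) :=
  { r | (∃ i j : Fin (m - 1), (i : ℕ) + 2 ≤ (j : ℕ) ∧
          r = FreeGroup.of i * FreeGroup.of j * (FreeGroup.of i)⁻¹ * (FreeGroup.of j)⁻¹) ∨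
        (∃ i j : Fin (m - 1), (j : ℕ) = (i : ℕ) + 1 ∧
          r = FreeGroup.of i * FreeGroup.of j * FreeGroup.of i *
              (FreeGroup.of j * FreeGroup.of i * FreeGroup.of j)⁻¹) }

/-- The braid group on `m` strands. -/
abbrev BraidGroup (m : ℕ) : Type := PresentedGroup (braidRels m)

/-- The braid generator `σ_{i+1}` of the braid group on `m` strands. -/
def σ {m : ℕ} (i : Fin (m - 1)) : BraidGroup m := PresentedGroup.of i

private lemma swap_commute {α : Type*} [DecidableEq α] {a b c d : α}
    (hac : a ≠ c) (had : a ≠ d) (hbc : b ≠ c) (hbd : b ≠ d) :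
    Equiv.swap a b * Equiv.swap c d = Equiv.swap c d * Equiv.swap a b := by
  have h := (Equiv.swap_apply_apply (Equiv.swap a b) c d).symm
  rw [Equiv.swap_apply_of_ne_of_ne hac.symm hbc.symm,
    Equiv.swap_apply_of_ne_of_ne had.symm hbd.symm] at h
  exact mul_inv_eq_iff_eq_mul.mp h

private lemma swap_braid {α : Type*} [DecidableEq α] {x y z : α}
    (hxy : x ≠ y) (hyz : y ≠ z) (hxz : x ≠ z) :
    Equiv.swap x y * Equiv.swap y z * Equiv.swap x y =
      Equiv.swap y z * Equiv.swap x y * Equiv.swap y z := by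
  have h1 := (Equiv.swap_apply_apply (Equiv.swap x y) y z).symm
  rw [Equiv.swap_apply_right, Equiv.swap_apply_of_ne_of_ne hxz.symm hyz.symm] at h1
  have h2 := (Equiv.swap_apply_apply (Equiv.swap y z) x y).symm
  rw [Equiv.swap_apply_of_ne_of_ne hxy hxz, Equiv.swap_apply_left] at h2
  rw [Equiv.swap_inv] at h1 h2
  calc Equiv.swap x y * Equiv.swap y z * Equiv.swap x y = Equiv.swap x z := h1
    _ = Equiv.swap y z * Equiv.swap x y * Equiv.swap y z := h2.symm

/-- The transposition `(i+1, i+2)`, as image of the braid generator `σ_{i+1}`. -/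
def braidGen (m : ℕ) (i : Fin (m - 1)) : Equiv.Perm (Fin m) :=
  Equiv.swap ⟨i.1, by have := i.isLt; omega⟩ ⟨i.1 + 1, by have := i.isLt; omega⟩

private lemma braid_rels_hold (m : ℕ) :
    ∀ r ∈ braidRels m, FreeGroup.lift (braidGen m) r = 1 := by
  rintro r (⟨i, j, hij, rfl⟩ | ⟨i, j, hij, rfl⟩) <;>
    simp only [map_mul, map_inv, FreeGroup.lift_apply_of]
  · rw [mul_inv_eq_one (a := _ * _ * _), mul_inv_eq_iff_eq_mul]
    unfold braidGen
    apply swap_commute <;> (simp only [ne_eq, Fin.mk.injEq]; omega)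
  · obtain ⟨jv, hjlt⟩ := j
    simp only [Fin.val_mk] at hij
    subst hij
    rw [mul_inv_eq_one (a := _ * _ * _)]
    unfold braidGen
    simp only [Fin.val_mk]
    apply swap_braid <;> (simp only [ne_eq, Fin.mk.injEq]; omega)

/-- The canonical surjection from the braid group on `m` strands to the symmetric
group on `m` letters, sending `σ_{i+1}` to the transposition `(i+1, i+2)`
(`0`-indexed: the swap of `i` and `i + 1` in `Fin m`). -/
def braidToPerm (m : ℕ) : BraidGroup m →* Equiv.Perm (Fin m) :=
  PresentedGroup.toGroup (braid_rels_hold m)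
/-- `altProd x y n` is the alternating product `x * y * x * y * ⋯` with `n` factors. -/
def altProd {G : Type*} [Monoid G] (x y : G) : ℕ → G
  | 0 => 1
  | n + 1 => x * altProd y x n

lemma altProd_add_two {G : Type*} [Monoid G] (x y : G) (n : ℕ) :
    altProd x y (n + 2) = x * y * altProd x y n := by
  simp [altProd, mul_assoc]

lemma altProd_two_mul {G : Type*} [Monoid G] (x y : G) (n : ℕ) :
    altProd x y (2 * n) = (x * y) ^ n := by
  induction n with
  | zero => simp [altProd]
  | succ m ih =>
    rw [show 2 * (m + 1) = 2 * m + 2 from by ring, altProd_add_two, ih, ← pow_succ']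

lemma altProd_two_mul_add_one {G : Type*} [Monoid G] (x y : G) (n : ℕ) :
    altProd x y (2 * n + 1) = (x * y) ^ n * x := by
  induction n with
  | zero => simp [altProd]
  | succ m ih =>
    rw [show 2 * (m + 1) + 1 = (2 * m + 1) + 2 from by ring, altProd_add_two, ih,
      ← mul_assoc, ← pow_succ']

/-- In a group, if `s` and `t` are involutions and `(s * t) ^ k = 1`, then the two
alternating products of `s` and `t` with `k` factors agree. -/
lemma altProd_swap_eq {G : Type*} [Group G] {s t : G} (hs : s * s = 1) (ht : t * t = 1)
    {k : ℕ} (h : (s * t) ^ k = 1) : altProd s t k = altProd t s k := by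
  have hs' : s⁻¹ = s := inv_eq_of_mul_eq_one_right hs
  have ht' : t⁻¹ = t := inv_eq_of_mul_eq_one_right ht
  have hts : t * s = (s * t)⁻¹ := by rw [mul_inv_rev, hs', ht']
  rcases Nat.even_or_odd k with ⟨m, hm⟩ | ⟨m, hm⟩
  · obtain rfl : k = 2 * m := by omega
    rw [altProd_two_mul, altProd_two_mul, hts, inv_pow]
    rw [show 2 * m = m + m from by ring, pow_add] at h
    exact (inv_eq_of_mul_eq_one_right h).symm
  · obtain rfl : k = 2 * m + 1 := by omega
    rw [altProd_two_mul_add_one, altProd_two_mul_add_one, hts, inv_pow]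
    rw [show 2 * m + 1 = m + (m + 1) from by ring, pow_add, pow_succ] at h
    rw [inv_eq_of_mul_eq_one_right h, mul_assoc, mul_assoc, ht, mul_one]

lemma map_altProd {G H : Type*} [Monoid G] [Monoid H] (φ : G →* H) (x y : G) (n : ℕ) :
    φ (altProd x y n) = altProd (φ x) (φ y) n := by
  induction n generalizing x y with
  | zero => simp [altProd]
  | succ m ih => simp [altProd, ih]
/-- The defining (Artin/braid) relation of the Artin group of type `I₂(k)`:
the two alternating products of the generators with `k` factors agree. -/
def I2Rels (k : ℕ) : Set (FreeGroup (Fin 2)) :=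
  { altProd (FreeGroup.of 0) (FreeGroup.of 1) k *
      (altProd (FreeGroup.of 1) (FreeGroup.of 0) k)⁻¹ }

/-- The Artin (generalized braid) group of type `I₂(k)`. -/
abbrev ArtinI2 (k : ℕ) : Type := PresentedGroup (I2Rels k)

/-- The first generator `s₁` of the Artin group of type `I₂(k)`. -/
def I2s₁ {k : ℕ} : ArtinI2 k := PresentedGroup.of 0

/-- The second generator `s₂` of the Artin group of type `I₂(k)`. -/
def I2s₂ {k : ℕ} : ArtinI2 k := PresentedGroup.of 1

/-- The canonical surjection from the Artin group of type `I₂(k)` onto the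
associated Coxeter group, the dihedral group of order `2k` (adding the relations
`s₁² = s₂² = 1`); it sends `s₁ ↦ sr 0` and `s₂ ↦ sr 1`. -/
def artinI2ToDihedral (k : ℕ) : ArtinI2 k →* DihedralGroup k :=
  PresentedGroup.toGroup (f := ![DihedralGroup.sr 0, DihedralGroup.sr 1])
    (by
      intro r hr
      simp only [I2Rels, Set.mem_singleton_iff] at hr
      subst hr
      rw [map_mul, map_inv, mul_inv_eq_one, map_altProd, map_altProd,
        FreeGroup.lift_apply_of, FreeGroup.lift_apply_of]
      simp only [Matrix.cons_val_zero, Matrix.cons_val_one, Matrix.head_cons]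
      refine altProd_swap_eq (DihedralGroup.sr_mul_self 0) (DihedralGroup.sr_mul_self 1) ?_
      rw [DihedralGroup.sr_mul_sr, sub_zero, DihedralGroup.r_one_pow_n])

section DihedralGroup

variable {G : Type*} [Group G]

/-- Two involutions whose product has `k`-th power `1` define a homomorphism from the dihedral
group of order `2k`. -/
lemma exists_dihedralGroup_hom {k : ℕ} {s t : G} (hs : s * s = 1) (ht : t * t = 1)
    (h : (s * t) ^ k = 1) :
    ∃ e : DihedralGroup k →* G, e (DihedralGroup.sr 0) = s ∧ e (DihedralGroup.sr 1) = t := by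
  let φ : ZMod k →+ Additive G := ZMod.lift k
    ⟨zmultiplesHom _ (Additive.ofMul (s * t)), by
      simp only [zmultiplesHom_apply, natCast_zsmul, ← ofMul_pow, h, ofMul_one]⟩
  let ρ : ZMod k → G := fun i => (φ i).toMul
  have hρ (n : ℤ) : ρ n = (s * t) ^ n := by
    simp only [ρ, φ, ZMod.lift_coe, zmultiplesHom_apply, ← ofMul_zpow, toMul_ofMul]
  have hadd (i j : ZMod k) : ρ (i + j) = ρ i * ρ j := by simp [ρ]
  have hconj (i : ZMod k) : ρ i * s = s * ρ (-i) := by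
    obtain ⟨n, rfl⟩ := ZMod.intCast_surjective i
    have hs' : s⁻¹ = s := inv_eq_of_mul_eq_one_right hs
    have ht' : t⁻¹ = t := inv_eq_of_mul_eq_one_right ht
    have h1 : s⁻¹ * (s * t) * s = (s * t)⁻¹ := by
      rw [mul_inv_rev, hs', ht', ← mul_assoc, hs, one_mul]
    have h2 : s⁻¹ * (s * t) ^ n * s = (s * t) ^ (-n) := by
      have := conj_zpow (a := s⁻¹) (b := s * t) (i := n)
      rw [inv_inv, h1, inv_zpow'] at this
      exact this.symm
    rw [← Int.cast_neg, hρ, hρ, ← h2]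
    group
  let F : DihedralGroup k → G
    | .r i => ρ i
    | .sr i => s * ρ i
  refine ⟨MonoidHom.mk' F ?_, ?_, ?_⟩
  · rintro (i | i) (j | j)
    · exact hadd i j
    · change s * ρ (j - i) = ρ i * (s * ρ j)
      rw [← mul_assoc, hconj, mul_assoc, ← hadd, neg_add_eq_sub]
    · change s * ρ (i + j) = s * ρ i * ρ j
      rw [hadd, mul_assoc]
    · change ρ (j - i) = s * ρ i * (s * ρ j)
      rw [mul_assoc, ← mul_assoc (ρ i), hconj, mul_assoc, ← hadd, ← mul_assoc, hs, one_mul,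
        neg_add_eq_sub]
  · change s * ρ 0 = s
    have := hρ 0
    simp_all
  · change s * ρ 1 = t
    have := hρ 1
    rw [Int.cast_one, zpow_one] at this
    rw [this, ← mul_assoc, hs, one_mul]

/-- A homomorphism from a dihedral group is injective if the rotation has full order and the
reflection is not mapped to a power of the image of the rotation. -/
lemma DihedralGroup.injective_of_zpow {k : ℕ} (e : DihedralGroup k →* G)
    (hr : ∀ n : ℤ, e (.r 1) ^ n = 1 → (k : ℤ) ∣ n) (hsr : ∀ n : ℤ, e (.sr 0) ≠ e (.r 1) ^ n) :
    Function.Injective e := by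
  rw [injective_iff_map_eq_one]
  rintro (i | i) hi
  · obtain ⟨n, rfl⟩ := ZMod.intCast_surjective i
    rw [← r_one_zpow, map_zpow] at hi
    rw [(ZMod.intCast_zmod_eq_zero_iff_dvd n k).2 (hr n hi), r_zero]
  · obtain ⟨n, rfl⟩ := ZMod.intCast_surjective i
    have h : e (sr 0) * e (r 1) ^ n = 1 := by
      rw [← map_zpow, ← map_mul, r_one_zpow, sr_mul_r, zero_add, hi]
    exact absurd (by rw [zpow_neg]; exact eq_inv_of_mul_eq_one_left h) (hsr (-n))

/-- The Artin relation of type `I₂(k)` for `s` and `t = s⁻¹ * y`, for even `k`. -/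
lemma altProd_swap_of_commute {s y : G} {j : ℕ} (h : Commute s (y ^ j)) :
    altProd s (s⁻¹ * y) (2 * j) = altProd (s⁻¹ * y) s (2 * j) := by
  rw [altProd_two_mul, altProd_two_mul, mul_inv_cancel_left]
  have := conj_pow (a := s⁻¹) (b := y) (i := j)
  rw [inv_inv] at this
  rw [this, mul_assoc, ← h.eq, inv_mul_cancel_left]

/-- The Artin relation of type `I₂(k)` for `s = y⁻ʲ * x` and `t = s⁻¹ * y`, for odd `k`. -/
lemma altProd_swap_of_sq_eq {s x y : G} {j : ℕ} (hs : y ^ j * s = x)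
    (h : x * x = y ^ (2 * j + 1)) :
    altProd s (s⁻¹ * y) (2 * j + 1) = altProd (s⁻¹ * y) s (2 * j + 1) := by
  rw [altProd_two_mul_add_one, altProd_two_mul_add_one, mul_inv_cancel_left]
  have h1 := conj_pow (a := s⁻¹) (b := y) (i := j)
  rw [inv_inv] at h1
  have h2 : s * (y ^ j * s) = y ^ (j + 1) := by
    apply mul_left_cancel (a := y ^ j)
    rw [← mul_assoc, hs, h, ← pow_add]
    congr 1
    omega
  rw [h1, ← mul_assoc, mul_assoc (s⁻¹ * y ^ j), mul_inv_cancel, mul_one, mul_assoc, ← pow_succ,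
    ← h2, inv_mul_cancel_left]

end DihedralGroup

section CoxeterElement

variable {G : Type*} [Group G]

/-- The product `g 0 * g 1 * ⋯ * g (p - 1)`. -/
def rangeProd (g : ℕ → G) : ℕ → G
  | 0 => 1
  | p + 1 => rangeProd g p * g p



/-- The braid relations for a sequence, the cubic ones being required below `N` only. -/
structure IsBraidSeq (g : ℕ → G) (N : ℕ) : Prop where
  comm : ∀ i j, i + 2 ≤ j → Commute (g i) (g j)
  braid : ∀ i, i + 1 < N → g i * g (i + 1) * g i = g (i + 1) * g i * g (i + 1)

namespace IsBraidSeq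

variable {g : ℕ → G} {N : ℕ}

lemma rangeProd_commute (hg : IsBraidSeq g N) {p i : ℕ} (h : p + 1 ≤ i) :
    Commute (rangeProd g p) (g i) := by
  induction p with
  | zero => exact Commute.one_left _
  | succ p ih => exact (ih (by omega)).mul_left (hg.comm p i (by omega))

lemma rangeProd_mul (hg : IsBraidSeq g N) {p i : ℕ} (hi : i + 2 ≤ p) (hp : p ≤ N) :
    rangeProd g p * g i = g (i + 1) * rangeProd g p := by
  induction p, hi using Nat.le_induction with
  | base =>
    calc rangeProd g i * g i * g (i + 1) * g i
        = rangeProd g i * (g i * g (i + 1) * g i) := by simp only [mul_assoc]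
      _ = rangeProd g i * g (i + 1) * (g i * g (i + 1)) := by
        rw [hg.braid i (by omega)]; simp only [mul_assoc]
      _ = g (i + 1) * (rangeProd g i * g i * g (i + 1)) := by
        rw [(hg.rangeProd_commute le_rfl).eq]; simp only [mul_assoc]
  | succ p hi ih =>
    rw [rangeProd, mul_assoc, ← (hg.comm i p hi).eq, ← mul_assoc, ih (by omega), mul_assoc]

lemma rangeProd_pow_mul (hg : IsBraidSeq g N) {a i : ℕ} (h : i + a + 1 ≤ N) :
    rangeProd g N ^ a * g i = g (i + a) * rangeProd g N ^ a := by
  induction a with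
  | zero => simp
  | succ a ih =>
    rw [pow_succ', mul_assoc, ih (by omega), ← mul_assoc, hg.rangeProd_mul (by omega) le_rfl,
      mul_assoc, add_assoc]

lemma rangeProd_mul_rangeProd (hg : IsBraidSeq g N) {p : ℕ} (hp : p + 1 ≤ N) :
    g 0 * (rangeProd g N * rangeProd g p) = rangeProd g (p + 1) * rangeProd g N := by
  induction p with
  | zero => simp [rangeProd]
  | succ p ih =>
    rw [rangeProd, ← mul_assoc (rangeProd g N), ← mul_assoc, ih (by omega), mul_assoc,
      hg.rangeProd_mul (by omega) le_rfl, ← mul_assoc, ← rangeProd]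

lemma rangeProd_sq_mul_last (hg : IsBraidSeq g (N + 1)) :
    rangeProd g (N + 1) ^ 2 * g N = g 0 * rangeProd g (N + 1) ^ 2 := by
  have h := hg.rangeProd_mul_rangeProd le_rfl
  rw [pow_two]
  nth_rw 1 [← h]
  simp only [mul_assoc]
  rfl

/-- The `(N + 1)`-st power of the Coxeter element `g 0 * ⋯ * g (N - 1)` is central. -/
lemma commute_rangeProd_pow (hg : IsBraidSeq g N) {i : ℕ} (hi : i < N) :
    Commute (g i) (rangeProd g N ^ (N + 1)) := by
  obtain ⟨M, rfl⟩ : ∃ M, N = M + 1 := ⟨N - 1, by omega⟩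
  set d := rangeProd g (M + 1) with hd
  have h1 : d ^ (M - i) * g i = g M * d ^ (M - i) := by
    have := hg.rangeProd_pow_mul (a := M - i) (i := i) (by omega)
    rwa [show i + (M - i) = M by omega] at this
  have h3 : d ^ i * g 0 = g i * d ^ i := by
    simpa using hg.rangeProd_pow_mul (a := i) (i := 0) (by omega)
  have h2 : d ^ 2 * g M = g 0 * d ^ 2 := hg.rangeProd_sq_mul_last
  have hp : d ^ (M + 1 + 1) = d ^ i * d ^ 2 * d ^ (M - i) := by
    rw [← pow_add, ← pow_add]; congr 1; omega
  change g i * d ^ (M + 1 + 1) = d ^ (M + 1 + 1) * g i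
  rw [hp, mul_assoc _ _ (g i), h1, ← mul_assoc _ (g M), mul_assoc _ _ (g M), h2,
    ← mul_assoc _ (g 0), h3]
  simp only [mul_assoc]

end IsBraidSeq

end CoxeterElement

/-- Induction on permutations of `Fin m` through products of adjacent transpositions. -/
lemma Equiv.Perm.fin_adjacent_swap_induction {m : ℕ} {P : Equiv.Perm (Fin m) → Prop} (one : P 1)
    (mul : ∀ p q, P p → P q → P (p * q))
    (swap : ∀ (i : ℕ) (h : i + 1 < m), P (Equiv.swap ⟨i, by omega⟩ ⟨i + 1, h⟩))
    (p : Equiv.Perm (Fin m)) : P p := by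
  cases m with
  | zero => rwa [Subsingleton.elim p 1]
  | succ n =>
    have hp : p ∈ Submonoid.closure (Set.range fun i : Fin n => Equiv.swap i.castSucc i.succ) := by
      rw [Equiv.Perm.mclosure_swap_castSucc_succ]
      trivial
    induction hp using Submonoid.closure_induction with
    | mem x hx =>
      obtain ⟨i, rfl⟩ := hx
      exact swap i (by omega)
    | one => exact one
    | mul x y _ _ hx hy => exact mul x y hx hy

section Braid

/-- The braid generators as a sequence, with value `1` beyond the last generator. -/
def braidSeq (m i : ℕ) : BraidGroup m := if h : i < m - 1 then σ ⟨i, h⟩ else 1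

lemma isBraidSeq_braidSeq (m : ℕ) : IsBraidSeq (braidSeq m) (m - 1) where
  comm i j hij := by
    by_cases hj : j < m - 1
    · have hi : i < m - 1 := by omega
      rw [braidSeq, braidSeq, dif_pos hi, dif_pos hj]
      have : PresentedGroup.mk (braidRels m) _ = 1 :=
        PresentedGroup.one_of_mem (Or.inl ⟨⟨i, hi⟩, ⟨j, hj⟩, hij, rfl⟩)
      rw [map_mul, map_mul, map_mul, map_inv, map_inv, mul_inv_eq_one, mul_inv_eq_iff_eq_mul] at this
      exact this
    · rw [braidSeq.eq_1 m j, dif_neg hj]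
      exact Commute.one_right _
  braid i hi := by
    rw [braidSeq, braidSeq, dif_pos hi, dif_pos (by omega : i < m - 1)]
    have : PresentedGroup.mk (braidRels m) _ = 1 :=
      PresentedGroup.one_of_mem (Or.inr ⟨⟨i, by omega⟩, ⟨i + 1, hi⟩, rfl, rfl⟩)
    rw [map_mul, map_inv, mul_inv_eq_one] at this
    simp only [map_mul] at this
    exact this

lemma braidToPerm_braidSeq {m i : ℕ} (h : i + 1 < m) :
    braidToPerm m (braidSeq m i) = Equiv.swap ⟨i, by omega⟩ ⟨i + 1, h⟩ := by
  rw [braidSeq, dif_pos (by omega)]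
  exact PresentedGroup.toGroup.of _

lemma swap_mk_apply_val {m i : ℕ} (h : i + 1 < m) (x : Fin m) :
    (Equiv.swap (⟨i, by omega⟩ : Fin m) ⟨i + 1, h⟩ x : ℕ) =
      if (x : ℕ) = i then i + 1 else if (x : ℕ) = i + 1 then i else x := by
  rw [Equiv.swap_apply_def]
  simp only [Fin.ext_iff]
  split_ifs <;> rfl

/-- The Coxeter element `σ₁ ⋯ σ_{m-1}` of the braid group, rotating the strands by one step. -/
def braidCoxeter (m : ℕ) : BraidGroup m := rangeProd (braidSeq m) (m - 1)

lemma braidToPerm_rangeProd_val {m p : ℕ} (hp : p < m) (x : Fin m) :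
    (braidToPerm m (rangeProd (braidSeq m) p) x : ℕ) =
      if (x : ℕ) < p then (x : ℕ) + 1 else if (x : ℕ) = p then 0 else x := by
  induction p generalizing x with
  | zero => simp [rangeProd]
  | succ p ih =>
    rw [rangeProd, map_mul, Equiv.Perm.mul_apply, ih (by omega), braidToPerm_braidSeq hp,
      swap_mk_apply_val hp]
    split_ifs <;> omega

lemma braidToPerm_braidCoxeter (m : ℕ) [NeZero m] :
    braidToPerm m (braidCoxeter m) = Equiv.addRight 1 := by
  have hm := NeZero.pos m
  ext x
  rw [braidCoxeter, braidToPerm_rangeProd_val (by omega), Equiv.coe_addRight, Fin.val_add,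
    Fin.val_one']
  have hx := x.isLt
  rw [Nat.add_mod_mod]
  split_ifs with h h'
  · rw [Nat.mod_eq_of_lt (by omega)]
  · rw [show (x : ℕ) + 1 = m by omega, Nat.mod_self]
  · omega

lemma commute_braidSeq_braidCoxeter_pow (m i : ℕ) :
    Commute (braidSeq m i) (braidCoxeter m ^ m) := by
  by_cases hi : i < m - 1
  · have := (isBraidSeq_braidSeq m).commute_rangeProd_pow hi
    rwa [show m - 1 + 1 = m by omega] at this
  · rw [braidSeq, dif_neg hi]
    exact Commute.one_left _

/-- Every permutation lifts to a braid commuting with the full twist. -/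
lemma exists_braidToPerm_eq {m : ℕ} (p : Equiv.Perm (Fin m)) :
    ∃ b : BraidGroup m, Commute b (braidCoxeter m ^ m) ∧ braidToPerm m b = p := by
  induction p using Equiv.Perm.fin_adjacent_swap_induction with
  | one => exact ⟨1, Commute.one_left _, map_one _⟩
  | mul p q hp hq =>
    obtain ⟨b, hb, rfl⟩ := hp
    obtain ⟨c, hc, rfl⟩ := hq
    exact ⟨b * c, hb.mul_left hc, map_mul _ _ _⟩
  | swap i h => exact ⟨braidSeq m i, commute_braidSeq_braidCoxeter_pow m i, braidToPerm_braidSeq h⟩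

/-- Performing a permutation of `k` letters simultaneously on both halves of `2k` strands can be
lifted to a braid commuting with the rotation by `k` steps. -/
lemma exists_braidToPerm_eq_double {k : ℕ} (p : Equiv.Perm (Fin k)) :
    ∃ b : BraidGroup (2 * k), Commute b (braidCoxeter (2 * k) ^ k) ∧
      ∀ i : Fin k, braidToPerm _ b ⟨i, by omega⟩ = ⟨p i, by omega⟩ ∧
        braidToPerm _ b ⟨i + k, by omega⟩ = ⟨p i + k, by omega⟩ := by
  induction p using Equiv.Perm.fin_adjacent_swap_induction with
  | one => exact ⟨1, Commute.one_left _, by simp⟩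
  | mul p q hp hq =>
    obtain ⟨b, hb, hb'⟩ := hp
    obtain ⟨c, hc, hc'⟩ := hq
    refine ⟨b * c, hb.mul_left hc, fun i => ?_⟩
    simp only [map_mul, Equiv.Perm.mul_apply, hc', hb', and_self]
  | swap i h =>
    have hg := isBraidSeq_braidSeq (2 * k)
    refine ⟨braidSeq _ i * braidSeq _ (i + k), ?_, fun x => ?_⟩
    · have h1 : braidCoxeter (2 * k) ^ k * braidSeq (2 * k) i =
          braidSeq (2 * k) (i + k) * braidCoxeter (2 * k) ^ k := hg.rangeProd_pow_mul (by omega)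
      have h2 : braidCoxeter (2 * k) ^ k * braidSeq (2 * k) (i + k) =
          braidSeq (2 * k) i * braidCoxeter (2 * k) ^ k := by
        apply mul_right_cancel (b := braidCoxeter (2 * k) ^ k)
        rw [mul_assoc, ← h1, ← mul_assoc, mul_assoc (braidSeq (2 * k) i), ← pow_add, ← two_mul]
        exact (commute_braidSeq_braidCoxeter_pow (2 * k) i).symm
      change _ * _ * _ = _ * (_ * _)
      rw [← mul_assoc, h1, mul_assoc _ _ (braidSeq (2 * k) (i + k)), h2, ← mul_assoc,
        (hg.comm i (i + k) (by omega)).eq]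
    · have hx := x.isLt
      simp only [map_mul, Equiv.Perm.mul_apply, Fin.ext_iff,
        braidToPerm_braidSeq (show i + 1 < 2 * k by omega),
        braidToPerm_braidSeq (show i + k + 1 < 2 * k by omega),
        swap_mk_apply_val h, swap_mk_apply_val (show i + 1 < 2 * k by omega),
        swap_mk_apply_val (show i + k + 1 < 2 * k by omega)]
      constructor <;> split_ifs <;> omega

end Braid

lemma Fin.zsmul_one_eq_zero_iff {m : ℕ} [NeZero m] (n : ℤ) :
    n • (1 : Fin m) = 0 ↔ (m : ℤ) ∣ n := by
  obtain ⟨l, rfl⟩ : ∃ l, m = l + 1 := ⟨m - 1, by have := NeZero.pos m; omega⟩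
  have h : addOrderOf (1 : Fin (l + 1)) = l + 1 := ZMod.addOrderOf_one (l + 1)
  rw [← addOrderOf_dvd_iff_zsmul_eq_zero, h]

lemma Fin.val_zsmul_one {m : ℕ} [NeZero m] (a : Fin m) : ((a : ℕ) : ℤ) • (1 : Fin m) = a := by
  obtain ⟨l, rfl⟩ : ∃ l, m = l + 1 := ⟨m - 1, by have := NeZero.pos m; omega⟩
  have h (b : ZMod (l + 1)) : (b.val : ℤ) • (1 : ZMod (l + 1)) = b := by
    rw [natCast_zsmul, nsmul_one, ZMod.natCast_zmod_val]
  exact h a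

lemma Fin.eq_zsmul_one_sub_iff {m : ℕ} [NeZero m] (a b : Fin m) (n : ℤ) :
    a = n • 1 - b ↔ (m : ℤ) ∣ a + b - n := by
  rw [← Fin.zsmul_one_eq_zero_iff, sub_smul, add_zsmul, Fin.val_zsmul_one, Fin.val_zsmul_one,
    sub_eq_zero, eq_sub_iff_add_eq]

lemma Equiv.addRight_zpow {A : Type*} [AddGroup A] (a : A) (n : ℤ) :
    (Equiv.addRight a : Equiv.Perm A) ^ n = Equiv.addRight (n • a) := by
  induction n using Int.induction_on with
  | zero => ext x; simp
  | succ n ih =>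
    rw [zpow_add_one, ih]
    ext x
    simp only [Equiv.Perm.mul_apply, Equiv.coe_addRight]
    rw [add_assoc, add_comm (n : ℤ), one_add_zsmul]
  | pred n ih =>
    rw [zpow_sub_one, ih, mul_inv_eq_iff_eq_mul]
    ext x
    simp only [Equiv.Perm.mul_apply, Equiv.coe_addRight]
    rw [add_assoc, ← one_add_zsmul]
    congr 2
    omega

/-- Braids `s` and `s⁻¹ * y` on `2k` strands satisfying the Artin relation, where `s` permutes the strands by a reflection without fixed vertices and `y` by the
rotation by two steps, give a representation of the Artin group of type `I₂(k)` as required. -/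
lemma exists_braid_representation_of_altProd {k : ℕ} [NeZero (2 * k)] {s y : BraidGroup (2 * k)}
    (h : altProd s (s⁻¹ * y) k = altProd (s⁻¹ * y) s k) {q : ℤ} (hq : Odd q)
    (hs : braidToPerm _ s = Equiv.subLeft (q • 1))
    (hy : braidToPerm _ y = Equiv.addRight ((2 : ℤ) • 1)) :
    ∃ (m : ℕ) (f : ArtinI2 k →* BraidGroup m) (e : DihedralGroup k →* Equiv.Perm (Fin m)),
      Function.Injective e ∧
      ∀ x : ArtinI2 k, braidToPerm m (f x) = e (artinI2ToDihedral k x) := by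
  set S := braidToPerm _ s with hS
  set T := braidToPerm _ (s⁻¹ * y) with hT
  have hST : S * T = Equiv.addRight ((2 : ℤ) • 1) := by
    rw [hS, hT, ← map_mul, mul_inv_cancel_left, hy]
  have hSS : S * S = 1 := by
    rw [hs]
    ext x
    simp
  have hT' : T = S * Equiv.addRight ((2 : ℤ) • 1) := by
    rw [← hST, ← mul_assoc, hSS, one_mul]
  have hTT : T * T = 1 := by
    rw [hT', hs]
    ext x
    congr 1
    simp only [Equiv.Perm.mul_apply, Equiv.coe_addRight, Equiv.subLeft_apply, Equiv.Perm.one_apply]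
    abel
  have hpow (n : ℤ) : (S * T) ^ n = Equiv.addRight ((2 * n) • 1) := by
    rw [hST, Equiv.addRight_zpow, ← mul_zsmul, mul_comm n]
  obtain ⟨e, he0, he1⟩ := exists_dihedralGroup_hom (k := k) hSS hTT (by
    rw [← zpow_natCast, hpow, (Fin.zsmul_one_eq_zero_iff _).2 (by simp)]
    ext x; simp)
  have her : e (.r 1) = S * T := by
    rw [← he0, ← he1, ← map_mul, DihedralGroup.sr_mul_sr, sub_zero]
  refine ⟨2 * k, PresentedGroup.toGroup (f := ![s, s⁻¹ * y]) ?_, e,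
    DihedralGroup.injective_of_zpow e ?_ ?_, fun x => ?_⟩
  · intro r hr
    rw [I2Rels, Set.mem_singleton_iff] at hr
    subst hr
    simpa [mul_inv_eq_one, map_altProd] using h
  · intro n hn
    rw [her, hpow] at hn
    have h0 := Equiv.congr_fun hn 0
    simp only [Equiv.coe_addRight, zero_add, Equiv.Perm.one_apply] at h0
    rw [Fin.zsmul_one_eq_zero_iff] at h0
    push_cast at h0
    exact Int.dvd_of_mul_dvd_mul_left two_ne_zero h0
  · intro n hn
    rw [her, hpow, he0, hs] at hn
    have h0 := Equiv.congr_fun hn 0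
    simp only [Equiv.coe_addRight, zero_add, Equiv.subLeft_apply, sub_zero] at h0
    rw [← sub_eq_zero, ← sub_smul,
      Fin.zsmul_one_eq_zero_iff] at h0
    push_cast at h0
    obtain ⟨c, hc⟩ := h0
    obtain ⟨d, hd⟩ := hq
    rw [mul_assoc] at hc
    omega
  · rw [← MonoidHom.comp_apply, ← MonoidHom.comp_apply]
    refine congrArg (fun φ : ArtinI2 k →* Equiv.Perm (Fin (2 * k)) => φ x) ?_
    refine PresentedGroup.ext fun i => ?_
    rw [MonoidHom.comp_apply, MonoidHom.comp_apply, PresentedGroup.toGroup.of, artinI2ToDihedral,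
      PresentedGroup.toGroup.of]
    fin_cases i
    · exact he0.symm
    · exact he1.symm

lemma braidToPerm_braidCoxeter_pow (m n : ℕ) [NeZero m] :
    braidToPerm m (braidCoxeter m ^ n) = Equiv.addRight ((n : ℤ) • 1) := by
  rw [map_pow, braidToPerm_braidCoxeter, ← zpow_natCast, Equiv.addRight_zpow]

/-- A braid on `2k` strands permuting them by a reflection of the `2k`-gon and commuting with the
rotation by `k` steps. -/
lemma exists_reflection_commute {k : ℕ} [NeZero (2 * k)] :
    ∃ b : BraidGroup (2 * k), Commute b (braidCoxeter (2 * k) ^ k) ∧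
      braidToPerm _ b = Equiv.subLeft (((k : ℤ) - 1) • 1) := by
  obtain ⟨b, hb, hb'⟩ := exists_braidToPerm_eq_double (Fin.revPerm (n := k))
  refine ⟨b, hb, Equiv.ext fun x => ?_⟩
  rw [Equiv.subLeft_apply, Fin.eq_zsmul_one_sub_iff]
  by_cases hx : (x : ℕ) < k
  · rw [(hb' ⟨x, hx⟩).1]
    simp only [Fin.revPerm_apply, Fin.val_rev]
    exact ⟨0, by omega⟩
  · have h := (hb' ⟨x - k, by omega⟩).2
    rw [show (⟨_, _⟩ : Fin (2 * k)) = x from Fin.ext (Nat.sub_add_cancel (not_lt.1 hx))] at h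
    rw [h]
    simp only [Fin.revPerm_apply, Fin.val_rev]
    exact ⟨1, by omega⟩

/-- A braid on `2k` strands permuting them by a reflection of the `2k`-gon whose square is the full
twist. -/
lemma exists_reflection_sq {k : ℕ} [NeZero (2 * k)] :
    ∃ x : BraidGroup (2 * k), x * x = braidCoxeter (2 * k) ^ (2 * k) ∧
      braidToPerm _ x = Equiv.subLeft ((-1 : ℤ) • 1) := by
  let F : Fin (2 * k) → Fin (2 * k) := fun i =>
    ⟨if (i : ℕ) < k then i else 3 * k - 1 - i, by split_ifs <;> omega⟩
  have hF : Function.Involutive F := by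
    intro i
    simp only [F, Fin.ext_iff]
    split_ifs <;> omega
  obtain ⟨b, hb, hb'⟩ := exists_braidToPerm_eq hF.toPerm
  refine ⟨b * braidCoxeter (2 * k) ^ k * b⁻¹, ?_, ?_⟩
  · rw [← pow_two, conj_pow, ← pow_mul, mul_comm k 2, hb.eq, mul_inv_cancel_right]
  · rw [map_mul, map_mul, map_inv, hb', braidToPerm_braidCoxeter_pow, mul_inv_eq_iff_eq_mul]
    refine Equiv.ext fun i => ?_
    have hi : i + (k : ℤ) • 1 =
        ⟨if (i : ℕ) < k then i + k else i - k, by split_ifs <;> omega⟩ := by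
      rw [← sub_eq_zero, ← Fin.val_zsmul_one ⟨_, _⟩]
      nth_rw 1 [← Fin.val_zsmul_one i]
      rw [← add_zsmul, ← sub_smul, Fin.zsmul_one_eq_zero_iff]
      simp only
      split_ifs
      · exact ⟨0, by omega⟩
      · exact ⟨1, by omega⟩
    simp only [Equiv.Perm.mul_apply, Equiv.coe_addRight, Equiv.subLeft_apply, hi,
      Function.Involutive.coe_toPerm]
    rw [Fin.eq_zsmul_one_sub_iff]
    simp only [F]
    split_ifs <;> exact ⟨1, by omega⟩

/-- Let `k ≥ 2`. There exist a natural number `m`, a group homomorphism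
`f` from the Artin group of type `I₂(k)` into the braid group on `m` strands, and an
injective group homomorphism `e` from the Coxeter group of type `I₂(k)` (the dihedral
group of order `2k`) into the symmetric group on `m` letters, such that
`π_m ∘ f = e ∘ π_S`, where `π_m` and `π_S` are the canonical surjections. -/
theorem exists_braid_representation_I2 (k : ℕ) (hk : 2 ≤ k) :
    ∃ (m : ℕ) (f : ArtinI2 k →* BraidGroup m)
      (e : DihedralGroup k →* Equiv.Perm (Fin m)),
      Function.Injective e ∧
      ∀ x : ArtinI2 k, braidToPerm m (f x) = e (artinI2ToDihedral k x) := by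
  have : NeZero (2 * k) := ⟨by omega⟩
  have hy : braidToPerm (2 * k) (braidCoxeter (2 * k) ^ 2) = Equiv.addRight ((2 : ℤ) • 1) :=
    braidToPerm_braidCoxeter_pow (2 * k) 2
  rcases Nat.even_or_odd' k with ⟨j, hj | hj⟩
  · obtain ⟨s, hs, hs'⟩ := exists_reflection_commute (k := k)
    refine exists_braid_representation_of_altProd (s := s) (y := braidCoxeter (2 * k) ^ 2) ?_
      (q := k - 1) ⟨j - 1, by omega⟩ hs' hy
    have h : Commute s ((braidCoxeter (2 * k) ^ 2) ^ j) := by rwa [← pow_mul, ← hj]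
    simpa only [← hj] using altProd_swap_of_commute h
  · obtain ⟨x, hx, hx'⟩ := exists_reflection_sq (k := k)
    refine exists_braid_representation_of_altProd
      (s := ((braidCoxeter (2 * k) ^ 2) ^ j)⁻¹ * x) (y := braidCoxeter (2 * k) ^ 2) ?_
      (q := -1 - 2 * j) ⟨-1 - j, by omega⟩ ?_ hy
    · have h := altProd_swap_of_sq_eq (mul_inv_cancel_left ((braidCoxeter (2 * k) ^ 2) ^ j) x)
        (by rw [hx, ← pow_mul, ← hj])
      simpa only [← hj] using h
    · rw [map_mul, map_inv, hx', ← pow_mul, braidToPerm_braidCoxeter_pow, inv_mul_eq_iff_eq_mul]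
      ext i
      congr 1
      simp only [Equiv.Perm.mul_apply, Equiv.coe_addRight, Equiv.subLeft_apply, sub_zsmul]
      push_cast
      abel
end

section
/- In the braid group B₈ on 8 strands, let a = σ₁σ₃σ₅σ₇ and b = σ₂σ₁σ₄σ₃σ₂σ₆σ₅σ₄σ₇σ₆. Then abab = baba. -/
lemma σ_mul_comm {m : ℕ} {i j : Fin (m - 1)} (h : (i : ℕ) + 2 ≤ j) :
    σ (m := m) i * σ j = σ j * σ i := by
  have h1 : PresentedGroup.mk (braidRels m) _ = 1 :=
    PresentedGroup.one_of_mem (Or.inl ⟨i, j, h, rfl⟩)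
  simp only [map_mul, map_inv] at h1
  exact mul_inv_eq_iff_eq_mul.mp (mul_inv_eq_one.mp h1)

lemma σ_braid {m : ℕ} {i j : Fin (m - 1)} (h : (j : ℕ) = i + 1) :
    σ (m := m) i * σ j * σ i = σ j * σ i * σ j := by
  have h1 : PresentedGroup.mk (braidRels m) _ = 1 :=
    PresentedGroup.one_of_mem (Or.inr ⟨i, j, h, rfl⟩)
  simp only [map_mul, map_inv] at h1
  exact mul_inv_eq_one.mp h1

/-- The braid represented by a positive word. -/
def positiveBraid {m : ℕ} (w : List (Fin (m - 1))) : BraidGroup m := (w.map σ).prod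

@[simp]
lemma positiveBraid_cons {m : ℕ} (i : Fin (m - 1)) (w : List (Fin (m - 1))) :
    positiveBraid (i :: w) = σ i * positiveBraid w := by
  simp [positiveBraid]

/-- Try to divide a positive word by `s` on the left, using the braid relations only.
The first argument bounds the recursion depth. -/
def leftQuotient {k : ℕ} : ℕ → Fin k → List (Fin k) → Option (List (Fin k))
  | 0, _, _ => none
  | _ + 1, _, [] => none
  | n + 1, s, t :: w =>
    if s = t then some w
    else if (s : ℕ) + 2 ≤ t ∨ (t : ℕ) + 2 ≤ s then (leftQuotient n s w).map (t :: ·)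
    else (leftQuotient n s w).bind fun r =>
      (leftQuotient n t r).map fun r' => t :: s :: r'

lemma positiveBraid_eq_of_leftQuotient {m : ℕ} (n : ℕ) (s : Fin (m - 1))
    (w r : List (Fin (m - 1))) (h : leftQuotient n s w = some r) :
    positiveBraid w = σ s * positiveBraid r := by
  induction n generalizing s w r with
  | zero => simp [leftQuotient] at h
  | succ n ih =>
    cases w with
    | nil => simp [leftQuotient] at h
    | cons t w =>
      rw [leftQuotient] at h
      split_ifs at h with hst hfar
      · obtain rfl := Option.some.inj h
        rw [hst, positiveBraid_cons]
      · obtain ⟨q, hq, rfl⟩ := Option.map_eq_some_iff.mp h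
        have hcomm : σ (m := m) t * σ s = σ s * σ t :=
          hfar.elim (fun h => (σ_mul_comm h).symm) σ_mul_comm
        rw [positiveBraid_cons, positiveBraid_cons, ih s w q hq, ← mul_assoc, hcomm, mul_assoc]
      · obtain ⟨q, hq, h'⟩ := Option.bind_eq_some_iff.mp h
        obtain ⟨q', hq', rfl⟩ := Option.map_eq_some_iff.mp h'
        have hbraid : σ (m := m) t * σ s * σ t = σ s * σ t * σ s := by
          have hne : (s : ℕ) ≠ t := fun h => hst (Fin.ext h)
          rcases Nat.lt_or_gt_of_ne hne with hlt | hlt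
          · exact (σ_braid (by omega)).symm
          · exact σ_braid (by omega)
        simp only [positiveBraid_cons, ih s w q hq, ih t q q' hq', ← mul_assoc, hbraid]

/-- A sufficient test for two positive words to represent the same braid. -/
def positiveWordsEq {k : ℕ} (n : ℕ) : List (Fin k) → List (Fin k) → Bool
  | u, [] => u.isEmpty
  | u, s :: v => (leftQuotient n s u).any fun r => positiveWordsEq n r v

lemma positiveBraid_eq_of_positiveWordsEq {m : ℕ} (n : ℕ) (u v : List (Fin (m - 1)))
    (h : positiveWordsEq n u v = true) : positiveBraid u = positiveBraid v := by
  induction v generalizing u with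
  | nil => rw [List.isEmpty_iff.mp h]
  | cons s v ih =>
    obtain ⟨r, hr, hrv⟩ := (Option.any_eq_true _ _).mp h
    rw [positiveBraid_eq_of_leftQuotient n s u r hr, ih r hrv, positiveBraid_cons]

/-- In the braid group `B₈`, with `a = σ₁ σ₃ σ₅ σ₇` and
`b = σ₂ σ₁ σ₄ σ₃ σ₂ σ₆ σ₅ σ₄ σ₇ σ₆`, one has `a b a b = b a b a`. -/
theorem braid8_I2_four_relation :
    ∀ a b : BraidGroup 8,
      a = σ (m := 8) ⟨0, by omega⟩ * σ (m := 8) ⟨2, by omega⟩ *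
          σ (m := 8) ⟨4, by omega⟩ * σ (m := 8) ⟨6, by omega⟩ →
      b = σ (m := 8) ⟨1, by omega⟩ * σ (m := 8) ⟨0, by omega⟩ *
          σ (m := 8) ⟨3, by omega⟩ * σ (m := 8) ⟨2, by omega⟩ *
          σ (m := 8) ⟨1, by omega⟩ * σ (m := 8) ⟨5, by omega⟩ *
          σ (m := 8) ⟨4, by omega⟩ * σ (m := 8) ⟨3, by omega⟩ *
          σ (m := 8) ⟨6, by omega⟩ * σ (m := 8) ⟨5, by omega⟩ →
      a * b * a * b = b * a * b * a := by
  intro a b ha hb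
  have h := positiveBraid_eq_of_positiveWordsEq (m := 8) 28
    [0, 2, 4, 6, 1, 0, 3, 2, 1, 5, 4, 3, 6, 5, 0, 2, 4, 6, 1, 0, 3, 2, 1, 5, 4, 3, 6, 5]
    [1, 0, 3, 2, 1, 5, 4, 3, 6, 5, 0, 2, 4, 6, 1, 0, 3, 2, 1, 5, 4, 3, 6, 5, 0, 2, 4, 6]
    (by rfl)
  simp only [positiveBraid, List.map_cons, List.map_nil, List.prod_cons, List.prod_nil,
    mul_one] at h
  subst ha hb
  simp only [mul_assoc]
  exact h
end

section
/- In the braid group B₈ on 8 strands, let b₂ = σ₂σ₆ and b₃ = σ₄σ₃σ₅σ₄. Then b₂b₃b₂ ≠ b₃b₂b₃. (Consequently, the natural set map f_S from the Artin group of type D₄ to B₈ defined by s₁ ↦ σ₃σ₅, s₂ ↦ σ₂σ₆, s₃ ↦ σ₄σ₃σ₅σ₄, s₄ ↦ σ₁σ₇ does not extend to a group homomorphism, even though the corresponding diagram of permutations commutes.) -/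
/-- The exponent sum homomorphism, sending every braid generator to `1`. -/
def exponentSum (m : ℕ) : BraidGroup m →* Multiplicative ℤ :=
  PresentedGroup.toGroup (f := fun _ => Multiplicative.ofAdd 1) (by
    rintro r (⟨i, j, -, rfl⟩ | ⟨i, j, -, rfl⟩) <;>
      simp only [map_mul, map_inv, FreeGroup.lift_apply_of] <;> group)

lemma exponentSum_σ {m : ℕ} (i : Fin (m - 1)) :
    exponentSum m (σ i) = Multiplicative.ofAdd 1 :=
  PresentedGroup.toGroup.of _

/-- In the braid group `B₈`, with `b₂ = σ₂ σ₆` and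
`b₃ = σ₄ σ₃ σ₅ σ₄`, one has `b₂ b₃ b₂ ≠ b₃ b₂ b₃`. (Hence the natural set map from the
Artin group of type `D₄` to `B₈` given by `s₁ ↦ σ₃σ₅`, `s₂ ↦ σ₂σ₆`, `s₃ ↦ σ₄σ₃σ₅σ₄`,
`s₄ ↦ σ₁σ₇` is not a group homomorphism.) -/
theorem D4_natural_map_not_hom :
    ∀ b₂ b₃ : BraidGroup 8,
      b₂ = σ (m := 8) ⟨1, by omega⟩ * σ (m := 8) ⟨5, by omega⟩ →
      b₃ = σ (m := 8) ⟨3, by omega⟩ * σ (m := 8) ⟨2, by omega⟩ *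
           σ (m := 8) ⟨4, by omega⟩ * σ (m := 8) ⟨3, by omega⟩ →
      b₂ * b₃ * b₂ ≠ b₃ * b₂ * b₃ := by
  rintro b₂ b₃ rfl rfl h
  have h' := congrArg (exponentSum 8) h
  simp only [map_mul, exponentSum_σ] at h'
  revert h'
  decide
end
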